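/- arXiv:2204.07849 — 7 statements merged into one kernel-verified Lean document; each statement's English description precedes it below -/
import Mathlib

section
/- Let c ≥ 0 be an integer and let L be the formal language over the alphabet Σ = {α_0, α_1, …, α_c, τ} consisting of all words of the form τ^{k_1} α_{i_1} τ^{k_2} α_{i_2} ⋯ τ^{k_d} α_{i_d} τ^{k_{d+1}} with d ≥ 0, indices 0 ≤ i_1, …, i_d ≤ c, exponents k_1, …, k_{d+1} ≥ 0, and k_{j+1} ≥ i_j for all 1 ≤ j < d. Then L equals the concatenation S* · {ε, α_0, α_1, …, α_c} · {τ}*, where S = {τ, α_0, α_1 τ, α_2 τ^2, …, α_c τ^c} and ε is the empty word; in particular L is a regular language. -/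
open Computability

/-- The alphabet `{α_0, …, α_c, τ}`: the letter `some i` is `α_i`, and `none` is `τ`. -/
abbrev Alph (c : ℕ) := Option (Fin (c + 1))

/-- The language of all words `τ^{k_1} α_{i_1} τ^{k_2} α_{i_2} ⋯ τ^{k_d} α_{i_d} τ^{k_{d+1}}`
with `d ≥ 0`, `0 ≤ i_1, …, i_d ≤ c`, `k_1, …, k_{d+1} ≥ 0` and `k_{j+1} ≥ i_j`
for all `1 ≤ j < d`. -/
def shiftLang (c : ℕ) : Language (Alph c) :=
  {w | ∃ (d : ℕ) (k : Fin (d + 1) → ℕ) (idx : Fin d → Fin (c + 1)),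
    (∀ j : Fin d, (j : ℕ) + 1 < d → (idx j : ℕ) ≤ k j.succ) ∧
    w = (List.ofFn fun j : Fin d =>
          List.replicate (k j.castSucc) (none : Alph c) ++ [some (idx j)]).flatten
        ++ List.replicate (k (Fin.last d)) (none : Alph c)}

/-- The language `S = {τ, α_0, α_1 τ, α_2 τ², …, α_c τ^c}`. -/
def langS (c : ℕ) : Language (Alph c) :=
  {w | w = [(none : Alph c)] ∨
    ∃ i : Fin (c + 1), w = some i :: List.replicate (i : ℕ) (none : Alph c)}

/-- The language `{ε, α_0, α_1, …, α_c}`. -/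
def langMid (c : ℕ) : Language (Alph c) :=
  {w | w = [] ∨ ∃ i : Fin (c + 1), w = [some i]}

/-- The language `{τ}`. -/
def langTau (c : ℕ) : Language (Alph c) := {[(none : Alph c)]}

/-- `Admissible n w`: the word `w` may follow a prefix which still requires `n` letters `τ`
before the next `α_i`. -/
def Admissible {c : ℕ} : ℕ → List (Alph c) → Prop
  | _, [] => True
  | n, none :: w => Admissible (n - 1) w
  | n, some i :: w => n = 0 ∧ Admissible (i : ℕ) w

/-- The language of words admissible after a prefix requiring `n` letters `τ`. -/
def admissibleLang (c n : ℕ) : Language (Alph c) := {w | Admissible n w}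

theorem admissible_replicate_append {c : ℕ} (m n : ℕ) (w : List (Alph c)) :
    Admissible n (List.replicate m none ++ w) ↔ Admissible (n - m) w := by
  induction m generalizing n with
  | zero => simp
  | succ m ih => simp [List.replicate_succ, Admissible, ih, Nat.sub_sub, Nat.add_comm]

theorem admissible_replicate {c : ℕ} (m n : ℕ) :
    Admissible n (List.replicate m (none : Alph c)) := by
  have := (admissible_replicate_append m n ([] : List (Alph c))).2 trivial
  simpa using this

theorem mem_kstar_langTau {c : ℕ} {w : List (Alph c)} :
    w ∈ (langTau c)∗ ↔ ∃ m, w = List.replicate m none := by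
  rw [Language.mem_kstar]
  constructor
  · rintro ⟨L, rfl, hL⟩
    refine ⟨L.length, ?_⟩
    rw [List.eq_replicate_of_mem (a := [none]) hL]
    simp
  · rintro ⟨m, rfl⟩
    refine ⟨List.replicate m [none], by simp, fun y hy => ?_⟩
    exact List.eq_of_mem_replicate hy

/-- The word `τ^{k_1} α_{i_1} ⋯ τ^{k_d} α_{i_d} τ^{k_{d+1}}`. -/
def shiftWord {c : ℕ} (d : ℕ) (k : Fin (d + 1) → ℕ) (idx : Fin d → Fin (c + 1)) :
    List (Alph c) :=
  (List.ofFn fun j : Fin d =>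
      List.replicate (k j.castSucc) (none : Alph c) ++ [some (idx j)]).flatten
    ++ List.replicate (k (Fin.last d)) (none : Alph c)

theorem shiftWord_succ {c d : ℕ} (k : Fin (d + 2) → ℕ) (idx : Fin (d + 1) → Fin (c + 1)) :
    shiftWord (d + 1) k idx = List.replicate (k 0) none ++
      some (idx 0) :: shiftWord d (fun j => k j.succ) (fun j => idx j.succ) := by
  simp [shiftWord, List.ofFn_succ]

theorem shiftWord_cons_add_one {c d : ℕ} (k : Fin (d + 1) → ℕ) (idx : Fin d → Fin (c + 1)) :
    shiftWord d (Fin.cons (k 0 + 1) (fun j => k j.succ)) idx = none :: shiftWord d k idx := by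
  cases d with
  | zero => simp [shiftWord, List.replicate_succ]
  | succ d => simp [shiftWord_succ, List.replicate_succ]

theorem admissible_shiftWord {c d n : ℕ} {k : Fin (d + 1) → ℕ} {idx : Fin d → Fin (c + 1)}
    (h : ∀ j : Fin d, (j : ℕ) + 1 < d → (idx j : ℕ) ≤ k j.succ) (hn : 0 < d → n ≤ k 0) :
    Admissible n (shiftWord d k idx) := by
  induction d generalizing n with
  | zero => simpa [shiftWord] using admissible_replicate _ _
  | succ d ih =>
    rw [shiftWord_succ, admissible_replicate_append]
    refine ⟨Nat.sub_eq_zero_of_le (hn d.succ_pos), ih (fun j hj => ?_) fun hd => ?_⟩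
    · exact h j.succ (by simpa using hj)
    · exact h 0 (by simpa using hd)

theorem Admissible.exists_shiftWord {c n : ℕ} {w : List (Alph c)} (hw : Admissible n w) :
    ∃ (d : ℕ) (k : Fin (d + 1) → ℕ) (idx : Fin d → Fin (c + 1)),
      (∀ j : Fin d, (j : ℕ) + 1 < d → (idx j : ℕ) ≤ k j.succ) ∧ (0 < d → n ≤ k 0) ∧
        w = shiftWord d k idx := by
  induction w generalizing n with
  | nil => exact ⟨0, fun _ => 0, Fin.elim0, fun j => j.elim0, by simp, by simp [shiftWord]⟩
  | cons a w ih =>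
    cases a with
    | none =>
      obtain ⟨d, k, idx, h, hn, rfl⟩ := ih (n := n - 1) hw
      refine ⟨d, Fin.cons (k 0 + 1) (fun j => k j.succ), idx, fun j hj => ?_, fun hd => ?_,
        (shiftWord_cons_add_one k idx).symm⟩
      · simpa using h j hj
      · have := hn hd
        simp only [Fin.cons_zero]
        omega
    | some i =>
      obtain ⟨rfl, hw⟩ := hw
      obtain ⟨d, k, idx, h, hn, rfl⟩ := ih hw
      refine ⟨d + 1, Fin.cons 0 k, Fin.cons i idx, fun j => ?_, by simp,
        by simp [shiftWord_succ]⟩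
      induction j using Fin.cases with
      | zero => simpa using hn
      | succ j => simpa using h j

theorem shiftLang_eq_admissibleLang (c : ℕ) : shiftLang c = admissibleLang c 0 := by
  ext w
  constructor
  · rintro ⟨d, k, idx, h, rfl⟩
    exact admissible_shiftWord h fun _ => Nat.zero_le _
  · intro hw
    obtain ⟨d, k, idx, h, -, hw⟩ := Admissible.exists_shiftWord hw
    exact ⟨d, k, idx, h, hw⟩

theorem append_mem_kstar_mul {α : Type*} {l m : Language α} {u v : List α} (hu : u ∈ l)
    (hv : v ∈ l∗ * m) : u ++ v ∈ l∗ * m := by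
  obtain ⟨x, ⟨L, rfl, hL⟩, y, hy, rfl⟩ := Language.mem_mul.1 hv
  refine Language.mem_mul.2 ⟨u ++ L.flatten, ⟨u :: L, by simp, ?_⟩, y, hy, by simp⟩
  simpa [hu] using hL

theorem mem_kstar_mul {α : Type*} {l m : Language α} {v : List α} (hv : v ∈ m) : v ∈ l∗ * m :=
  Language.mem_mul.2 ⟨[], Language.nil_mem_kstar l, v, hv, rfl⟩

theorem Admissible.mem_langTau_or_append {c n : ℕ} {w : List (Alph c)} (hw : Admissible n w) :
    (∃ m, w = List.replicate m none) ∨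
      ∃ v ∈ (langS c)∗ * (langMid c * (langTau c)∗), w = List.replicate n none ++ v := by
  induction w generalizing n with
  | nil => exact .inl ⟨0, rfl⟩
  | cons a w ih =>
    cases a with
    | none =>
      obtain ⟨m, rfl⟩ | ⟨v, hv, rfl⟩ := ih (n := n - 1) hw
      · exact .inl ⟨m + 1, rfl⟩
      · right
        cases n with
        | zero => exact ⟨none :: v, append_mem_kstar_mul (u := [none]) (.inl rfl) hv, rfl⟩
        | succ n => exact ⟨v, hv, rfl⟩
    | some i =>
      obtain ⟨rfl, hw⟩ := hw
      refine .inr ⟨some i :: w, ?_, rfl⟩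
      obtain ⟨m, rfl⟩ | ⟨v, hv, rfl⟩ := ih hw
      · exact mem_kstar_mul (Language.append_mem_mul (a := [some i]) (.inr ⟨i, rfl⟩)
          (mem_kstar_langTau.2 ⟨m, rfl⟩))
      · exact append_mem_kstar_mul (u := some i :: List.replicate (i : ℕ) none)
          (.inr ⟨i, rfl⟩) hv

theorem Admissible.append_of_mem_langS {c : ℕ} {u w : List (Alph c)} (hu : u ∈ langS c)
    (hw : Admissible 0 w) : Admissible 0 (u ++ w) := by
  obtain rfl | ⟨i, rfl⟩ := hu
  · exact hw
  · refine ⟨rfl, (admissible_replicate_append _ _ _).2 ?_⟩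
    rwa [Nat.sub_self]

theorem admissibleLang_zero_eq (c : ℕ) :
    admissibleLang c 0 = (langS c)∗ * langMid c * (langTau c)∗ := by
  rw [mul_assoc]
  ext w
  constructor
  · intro hw
    obtain ⟨m, rfl⟩ | ⟨v, hv, rfl⟩ := Admissible.mem_langTau_or_append hw
    · exact mem_kstar_mul (Language.append_mem_mul (a := []) (.inl rfl)
        (mem_kstar_langTau.2 ⟨m, rfl⟩))
    · exact hv
  · intro hw
    obtain ⟨x, ⟨L, rfl, hL⟩, y, hy, rfl⟩ := Language.mem_mul.1 hw
    obtain ⟨a, ha, b, hb, rfl⟩ := Language.mem_mul.1 hy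
    obtain ⟨m, rfl⟩ := mem_kstar_langTau.1 hb
    change Admissible 0 _
    induction L with
    | nil =>
      obtain rfl | ⟨i, rfl⟩ := ha
      · exact admissible_replicate m 0
      · exact ⟨rfl, admissible_replicate m i⟩
    | cons u L ih =>
      simp only [List.flatten_cons, List.append_assoc]
      rw [List.forall_mem_cons] at hL
      refine Admissible.append_of_mem_langS hL.1 (ih hL.2 ?_)
      exact Language.append_mem_mul (Language.join_mem_kstar hL.2) hy

theorem leftQuotient_admissibleLang {c n : ℕ} (hn : n ≤ c) (x : List (Alph c)) :
    (admissibleLang c n).leftQuotient x = 0 ∨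
      ∃ m ≤ c, (admissibleLang c n).leftQuotient x = admissibleLang c m := by
  induction x generalizing n with
  | nil => exact .inr ⟨n, hn, rfl⟩
  | cons a x ih =>
    cases a with
    | none => exact ih (n := n - 1) (by omega)
    | some i =>
      by_cases h : n = 0
      · subst h
        have : (admissibleLang c 0).leftQuotient (some i :: x) =
            (admissibleLang c i).leftQuotient x := by
          ext y
          exact and_iff_right rfl
        rw [this]
        exact ih (Nat.lt_succ_iff.1 i.2)
      · left
        ext y
        exact iff_of_false (fun hy => h hy.1) (Language.notMem_zero y)

theorem isRegular_admissibleLang (c : ℕ) : (admissibleLang c 0).IsRegular := by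
  refine Language.IsRegular.of_finite_range_leftQuotient
    (Set.Finite.subset (((Set.finite_Iic c).image (admissibleLang c)).insert 0) ?_)
  rintro _ ⟨x, rfl⟩
  obtain h | ⟨m, hm, h⟩ := leftQuotient_admissibleLang (Nat.zero_le c) x
  · exact .inl h
  · exact .inr ⟨m, hm, h.symm⟩

/-- `L` equals `S∗ · {ε, α_0, …, α_c} · {τ}∗` where
`S = {τ, α_0, α_1 τ, α_2 τ², …, α_c τ^c}`; in particular `L` is regular. -/
theorem stmt0 (c : ℕ) :
    shiftLang c = (langS c)∗ * langMid c * (langTau c)∗ ∧ (shiftLang c).IsRegular := by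
  rw [shiftLang_eq_admissibleLang]
  exact ⟨admissibleLang_zero_eq c, isRegular_admissibleLang c⟩
end

section
/- If L_A ⊆ Σ_A* and L_B ⊆ Σ_B* are regular languages, then their Segre product L_A ⊠ L_B is a regular language over the alphabet Σ_A ⊠ Σ_B. -/
/-!
The alphabet `Σ_A` is `Fin a ⊕ Fin p`: `Sum.inl t` is the letter `τ_{1,t}` and
`Sum.inr i` is the letter `α_i`.  Similarly `Σ_B = Fin b ⊕ Fin q` with letters
`τ_{2,t}` and `β_j`.  The Segre alphabet `Σ_A ⊠ Σ_B` is `(Fin a ⊕ Fin b) ⊕ (Fin p × Fin q)`,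
where `Sum.inl (Sum.inl t) = τ_{1,t}`, `Sum.inl (Sum.inr t) = τ_{2,t}` and
`Sum.inr (i, j) = γ_{i,j}`.
-/

/-- The Segre product of two languages: words
`w₁ v₁ γ_{i₁,j₁} w₂ v₂ γ_{i₂,j₂} ⋯ w_d v_d γ_{i_d,j_d} w_{d+1} v_{d+1}` where each `w_l`
is a word in the letters `τ_{1,·}`, each `v_l` is a word in the letters `τ_{2,·}`, and
`w₁ α_{i₁} ⋯ w_d α_{i_d} w_{d+1} ∈ L_A`, `v₁ β_{j₁} ⋯ v_d β_{j_d} v_{d+1} ∈ L_B`. -/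
def segreLang {a p b q : ℕ} (LA : Language (Fin a ⊕ Fin p)) (LB : Language (Fin b ⊕ Fin q)) :
    Language ((Fin a ⊕ Fin b) ⊕ (Fin p × Fin q)) :=
  {w | ∃ (d : ℕ) (ws : Fin (d + 1) → List (Fin a)) (vs : Fin (d + 1) → List (Fin b))
      (g : Fin d → Fin p × Fin q),
    w = (List.ofFn fun l : Fin d =>
          (ws l.castSucc).map (fun x => Sum.inl (Sum.inl x)) ++
          (vs l.castSucc).map (fun x => Sum.inl (Sum.inr x)) ++ [Sum.inr (g l)]).flatten
        ++ (ws (Fin.last d)).map (fun x => Sum.inl (Sum.inl x))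
        ++ (vs (Fin.last d)).map (fun x => Sum.inl (Sum.inr x)) ∧
    ((List.ofFn fun l : Fin d =>
        (ws l.castSucc).map Sum.inl ++ [Sum.inr (g l).1]).flatten
      ++ (ws (Fin.last d)).map Sum.inl) ∈ LA ∧
    ((List.ofFn fun l : Fin d =>
        (vs l.castSucc).map Sum.inl ++ [Sum.inr (g l).2]).flatten
      ++ (vs (Fin.last d)).map Sum.inl) ∈ LB}

/-- The preimage of a regular language under a partial letter-to-letter map is regular. -/
theorem Language.IsRegular.filterMap_preimage {α β : Type*} {L : Language β} (hL : L.IsRegular)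
    (f : α → Option β) : Language.IsRegular {w : List α | w.filterMap f ∈ L} := by
  obtain ⟨σ, _, M, rfl⟩ := hL
  refine Language.isRegular_iff.2
    ⟨σ, inferInstance, ⟨fun s x => (f x).elim s (M.step s), M.start, M.accept⟩, ?_⟩
  have key (w : List α) (s : σ) :
      List.foldl (fun s x => (f x).elim s (M.step s)) s w = M.evalFrom s (w.filterMap f) := by
    induction w generalizing s with
    | nil => rfl
    | cons x w ih => cases h : f x <;> simp [ih, h]
  ext w
  exact (congrArg (· ∈ M.accept) (key w M.start)).to_iff

open Classical in
/-- The words over a finite alphabet whose consecutive letters are related by `R` form a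
regular language. -/
theorem Language.isRegular_isChain {α : Type*} [Finite α] (R : α → α → Prop) :
    Language.IsRegular {w : List α | w.IsChain R} := by
  have := Fintype.ofFinite α
  let step : Option (Option α) → α → Option (Option α) := fun s x =>
    s.bind fun o => if ∀ y ∈ o, R y x then some (some x) else none
  refine Language.isRegular_iff.2
    ⟨Option (Option α), inferInstance, ⟨step, some none, {s | s ≠ none}⟩, ?_⟩
  have dead (w : List α) : List.foldl step none w = none := by
    induction w with
    | nil => rfl
    | cons x w ih => exact ih
  have key (w : List α) (x : α) :
      List.foldl step (some (some x)) w ≠ none ↔ (x :: w).IsChain R := by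
    induction w generalizing x with
    | nil => simp
    | cons y w ih =>
      by_cases h : R x y
      · simpa [step, h] using ih y
      · change List.foldl step (step (some (some x)) y) w ≠ none ↔ _
        have hs : step (some (some x)) y = none := by simp [step, h]
        simp [hs, h, dead]
  ext w
  change List.foldl step (some none) w ≠ none ↔ w.IsChain R
  cases w with
  | nil => simp
  | cons x w => simpa [step] using key w x

namespace SegreProduct

variable {A B P Q : Type*}

/-- The word `w₁ v₁ γ₁ ⋯ w_d v_d γ_d w_{d+1} v_{d+1}`. -/
def word (d : ℕ) (ws : Fin (d + 1) → List A) (vs : Fin (d + 1) → List B) (g : Fin d → P × Q) :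
    List ((A ⊕ B) ⊕ (P × Q)) :=
  (List.ofFn fun l : Fin d =>
      (ws l.castSucc).map (fun x => Sum.inl (Sum.inl x)) ++
      (vs l.castSucc).map (fun x => Sum.inl (Sum.inr x)) ++ [Sum.inr (g l)]).flatten
    ++ (ws (Fin.last d)).map (fun x => Sum.inl (Sum.inl x))
    ++ (vs (Fin.last d)).map (fun x => Sum.inl (Sum.inr x))

/-- The projection of letters to the first alphabet, erasing the `τ`-letters of the second. -/
def fstLetter : (A ⊕ B) ⊕ (P × Q) → Option (A ⊕ P)
  | .inl (.inl x) => some (.inl x)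
  | .inl (.inr _) => none
  | .inr g => some (.inr g.1)

/-- The projection of letters to the second alphabet, erasing the `τ`-letters of the first. -/
def sndLetter : (A ⊕ B) ⊕ (P × Q) → Option (B ⊕ Q)
  | .inl (.inl _) => none
  | .inl (.inr x) => some (.inl x)
  | .inr g => some (.inr g.2)

/-- Two letters may be consecutive unless they are a second `τ`-letter followed by a first
`τ`-letter. -/
def MayPrecede : (A ⊕ B) ⊕ (P × Q) → (A ⊕ B) ⊕ (P × Q) → Prop
  | .inl (.inr _), .inl (.inl _) => False
  | _, _ => True

theorem word_succ (d : ℕ) (ws : Fin (d + 2) → List A) (vs : Fin (d + 2) → List B)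
    (g : Fin (d + 1) → P × Q) :
    word (d + 1) ws vs g = (ws 0).map (fun x => Sum.inl (Sum.inl x)) ++
      ((vs 0).map (fun x => Sum.inl (Sum.inr x)) ++
        Sum.inr (g 0) :: word d (Fin.tail ws) (Fin.tail vs) (Fin.tail g)) := by
  simp [word, List.ofFn_succ, Fin.tail]

theorem filterMap_fstLetter_word (d : ℕ) (ws : Fin (d + 1) → List A) (vs : Fin (d + 1) → List B)
    (g : Fin d → P × Q) :
    (word d ws vs g).filterMap fstLetter =
      (List.ofFn fun l : Fin d => (ws l.castSucc).map Sum.inl ++ [Sum.inr (g l).1]).flatten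
        ++ (ws (Fin.last d)).map Sum.inl := by
  induction d with
  | zero => simp [word, List.filterMap_map, Function.comp_def, fstLetter]
  | succ d ih =>
    rw [word_succ]
    simp [ih, List.filterMap_map, Function.comp_def, fstLetter, List.ofFn_succ, Fin.tail]

theorem filterMap_sndLetter_word (d : ℕ) (ws : Fin (d + 1) → List A) (vs : Fin (d + 1) → List B)
    (g : Fin d → P × Q) :
    (word d ws vs g).filterMap sndLetter =
      (List.ofFn fun l : Fin d => (vs l.castSucc).map Sum.inl ++ [Sum.inr (g l).2]).flatten
        ++ (vs (Fin.last d)).map Sum.inl := by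
  induction d with
  | zero => simp [word, List.filterMap_map, Function.comp_def, sndLetter]
  | succ d ih =>
    rw [word_succ]
    simp [ih, List.filterMap_map, Function.comp_def, sndLetter, List.ofFn_succ, Fin.tail]

theorem isChain_map_append_map_append (u : List A) (v : List B) {l : List ((A ⊕ B) ⊕ (P × Q))}
    (hl : l.IsChain MayPrecede) (hhead : ∀ x, Sum.inl (Sum.inl x) ∉ l.head?) :
    (u.map (fun x => Sum.inl (Sum.inl x)) ++
      (v.map (fun x => Sum.inl (Sum.inr x)) ++ l)).IsChain MayPrecede := by
  induction u with
  | nil =>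
    induction v with
    | nil => exact hl
    | cons y v ih =>
      refine List.isChain_cons.2 ⟨?_, ih⟩
      rintro ((x | x) | x) hx
      · cases v <;> simp_all
      all_goals trivial
  | cons y u ih => exact List.isChain_cons.2 ⟨fun _ _ => trivial, ih⟩

theorem isChain_word (d : ℕ) (ws : Fin (d + 1) → List A) (vs : Fin (d + 1) → List B)
    (g : Fin d → P × Q) : (word d ws vs g).IsChain MayPrecede := by
  induction d with
  | zero =>
    simpa [word] using isChain_map_append_map_append (P := P) (Q := Q) (ws 0) (vs 0)
      List.IsChain.nil (by simp)
  | succ d ih =>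
    rw [word_succ]
    exact isChain_map_append_map_append _ _
      (List.isChain_cons.2 ⟨fun _ _ => trivial, ih _ _ _⟩) (by simp)

theorem cons_fst_word (x : A) (d : ℕ) (ws : Fin (d + 1) → List A) (vs : Fin (d + 1) → List B)
    (g : Fin d → P × Q) :
    word d (Fin.cons (x :: ws 0) (Fin.tail ws)) vs g = Sum.inl (Sum.inl x) :: word d ws vs g := by
  cases d with
  | zero => simp [word]
  | succ d => simp [word_succ]

theorem cons_snd_word (x : B) (d : ℕ) (ws : Fin (d + 1) → List A) (vs : Fin (d + 1) → List B)
    (g : Fin d → P × Q) (h : ws 0 = []) :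
    word d ws (Fin.cons (x :: vs 0) (Fin.tail vs)) g = Sum.inl (Sum.inr x) :: word d ws vs g := by
  cases d with
  | zero => simp [word, h]
  | succ d => simp [word_succ, h]

theorem head?_word {x : A} {u : List A} (d : ℕ) (ws : Fin (d + 1) → List A)
    (vs : Fin (d + 1) → List B) (g : Fin d → P × Q) (h : ws 0 = x :: u) :
    (word d ws vs g).head? = some (Sum.inl (Sum.inl x)) := by
  cases d with
  | zero => simp [word, h]
  | succ d => simp [word_succ, h]

theorem exists_eq_word_of_isChain {w : List ((A ⊕ B) ⊕ (P × Q))} (hw : w.IsChain MayPrecede) :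
    ∃ d ws vs g, w = word d ws vs g := by
  induction w with
  | nil => exact ⟨0, fun _ => [], fun _ => [], Fin.elim0, by simp [word]⟩
  | cons y w ih =>
    obtain ⟨hy, hw⟩ := List.isChain_cons.1 hw
    obtain ⟨d, ws, vs, g, rfl⟩ := ih hw
    rcases y with (x | x) | x
    · exact ⟨d, _, vs, g, (cons_fst_word x d ws vs g).symm⟩
    · refine ⟨d, ws, _, g, (cons_snd_word x d ws vs g ?_).symm⟩
      cases h : ws 0 with
      | nil => rfl
      | cons z u => exact (hy _ (head?_word d ws vs g h)).elim
    · exact ⟨d + 1, Fin.cons [] ws, Fin.cons [] vs, Fin.cons x g, by simp [word_succ]⟩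

end SegreProduct

open SegreProduct in
theorem mem_segreLang_iff {a p b q : ℕ} (LA : Language (Fin a ⊕ Fin p))
    (LB : Language (Fin b ⊕ Fin q)) (w : List ((Fin a ⊕ Fin b) ⊕ (Fin p × Fin q))) :
    w ∈ segreLang LA LB ↔ (w.filterMap fstLetter ∈ LA ∧ w.filterMap sndLetter ∈ LB) ∧
      w.IsChain MayPrecede := by
  constructor
  · rintro ⟨d, ws, vs, g, rfl, hA, hB⟩
    rw [← filterMap_fstLetter_word d ws vs g] at hA
    rw [← filterMap_sndLetter_word d ws vs g] at hB
    exact ⟨⟨hA, hB⟩, isChain_word d ws vs g⟩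
  · rintro ⟨⟨hA, hB⟩, hw⟩
    obtain ⟨d, ws, vs, g, rfl⟩ := exists_eq_word_of_isChain hw
    rw [filterMap_fstLetter_word] at hA
    rw [filterMap_sndLetter_word] at hB
    exact ⟨d, ws, vs, g, rfl, hA, hB⟩

/-- If `L_A` and `L_B` are regular languages, then their Segre product `L_A ⊠ L_B`
is a regular language. -/
theorem stmt1 {a p b q : ℕ} (LA : Language (Fin a ⊕ Fin p)) (LB : Language (Fin b ⊕ Fin q))
    (hA : LA.IsRegular) (hB : LB.IsRegular) : (segreLang LA LB).IsRegular := by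
  have h := ((hA.filterMap_preimage SegreProduct.fstLetter).inf
    (hB.filterMap_preimage SegreProduct.sndLetter)).inf
    (Language.isRegular_isChain (SegreProduct.MayPrecede (A := Fin a) (B := Fin b)
      (P := Fin p) (Q := Fin q)))
  convert h using 1
  ext w
  exact mem_segreLang_iff LA LB w
end

section
/- Fix an integer c ≥ 0. A monomial x^a in the variables x_1, x_2, x_3, … (i.e. a finitely supported function a from the positive integers to the nonnegative integers) belongs to the multiplicative monoid generated by the quadratic monomials {x_i x_j : i ≥ 1, i ≤ j ≤ i + c} if and only if there exist d ≥ 0 and a nondecreasing sequence of positive integers i_1 ≤ i_2 ≤ ⋯ ≤ i_{2d} with i_{2k} − i_{2k−1} ≤ c for all 1 ≤ k ≤ d such that x^a = x_{i_1} x_{i_2} ⋯ x_{i_{2d}}. -/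
/-!
Monomials in the variables `x_1, x_2, x_3, …` are identified with finitely supported
functions `ℕ →₀ ℕ` (the variable `x_0` is never used: all generators and all claimed
factorizations only involve indices `≥ 1`), multiplied by adding exponent vectors.
-/

/-- The generators `x_i x_j` with `i ≥ 1` and `i ≤ j ≤ i + c`, as exponent vectors. -/
def quadGens (c : ℕ) : Set (ℕ →₀ ℕ) :=
  {u | ∃ i j : ℕ, 1 ≤ i ∧ i ≤ j ∧ j ≤ i + c ∧ u = Finsupp.single i 1 + Finsupp.single j 1}

/-- Nondecreasing lists of positive integers of even length whose consecutive disjoint pairs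
have gap at most `c`. -/
inductive IsPairedSorted (c : ℕ) : List ℕ → Prop
  | nil : IsPairedSorted c []
  | cons {p q : ℕ} {l : List ℕ} (hp : 1 ≤ p) (hpq : p ≤ q) (hq : q ≤ p + c)
      (hl : ∀ x ∈ l, q ≤ x) (h : IsPairedSorted c l) : IsPairedSorted c (p :: q :: l)

namespace IsPairedSorted

variable {c : ℕ} {l : List ℕ}

/-- A pair with gap at most `c` can be merged into a paired sorted list. -/
theorem exists_perm_cons_cons (h : IsPairedSorted c l) {p q : ℕ} (hp : 1 ≤ p) (hpq : p ≤ q)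
    (hq : q ≤ p + c) : ∃ l', IsPairedSorted c l' ∧ l'.Perm (p :: q :: l) := by
  induction h generalizing p q with
  | nil => exact ⟨[p, q], .cons hp hpq hq (by simp) .nil, .refl _⟩
  | @cons a b t ha hab hb ht _ ih =>
    obtain ⟨w, x, y, z, hw, hwx, hxw, hxy, hyz, hzy, hxb, hperm⟩ :
        ∃ w x y z : ℕ, 1 ≤ w ∧ w ≤ x ∧ x ≤ w + c ∧ x ≤ y ∧ y ≤ z ∧ z ≤ y + c ∧ x ≤ b ∧
          [w, x, y, z].Perm [p, q, a, b] := by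
      rcases le_total p a with h₁ | h₁
      · rcases le_total q a with h₂ | h₂
        · exact ⟨p, q, a, b, by omega, by omega, by omega, by omega, by omega, by omega,
            by omega, .refl _⟩
        · rcases le_total q b with h₃ | h₃
          · exact ⟨p, a, q, b, by omega, by omega, by omega, by omega, by omega, by omega,
              by omega, by grind⟩
          · exact ⟨p, a, b, q, by omega, by omega, by omega, by omega, by omega, by omega,
              by omega, by grind⟩
      · rcases le_total b p with h₂ | h₂
        · exact ⟨a, b, p, q, by omega, by omega, by omega, by omega, by omega, by omega,
            by omega, by grind⟩
        · rcases le_total q b with h₃ | h₃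
          · exact ⟨a, p, q, b, by omega, by omega, by omega, by omega, by omega, by omega,
              by omega, by grind⟩
          · exact ⟨a, p, b, q, by omega, by omega, by omega, by omega, by omega, by omega,
              by omega, by grind⟩
    obtain ⟨l', hl', hperm'⟩ := ih (p := y) (q := z) (by omega) hyz hzy
    refine ⟨w :: x :: l', .cons hw hwx hxw (fun u hu => ?_) hl', ?_⟩
    · have hu' := hperm'.mem_iff.1 hu
      simp only [List.mem_cons] at hu'
      rcases hu' with rfl | rfl | hu'
      · exact hxy
      · omega
      · exact hxb.trans (ht u hu')
    · exact ((hperm'.cons x).cons w).trans (hperm.append_right t)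

theorem even_length (h : IsPairedSorted c l) : Even l.length := by
  induction h with
  | nil => simp
  | cons _ _ _ _ _ ih => simpa [Nat.even_add_one] using ih

theorem one_le (h : IsPairedSorted c l) : ∀ x ∈ l, 1 ≤ x := by
  induction h with
  | nil => simp
  | cons => grind

theorem pairwise_le (h : IsPairedSorted c l) : l.Pairwise (· ≤ ·) := by
  induction h with
  | nil => simp
  | cons _ hpq _ hl _ ih =>
    exact ((ih.cons hl).cons fun x hx => (List.mem_cons.1 hx).elim (fun h => h ▸ hpq)
      fun h => hpq.trans (hl x h))

theorem getElem_le (h : IsPairedSorted c l) (k : ℕ) (hk : 2 * k + 1 < l.length) :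
    l[2 * k + 1] ≤ l[2 * k] + c := by
  induction h generalizing k with
  | nil => simp at hk
  | cons _ _ hq _ _ ih =>
    cases k with
    | zero => simpa using hq
    | succ k => simpa [Nat.mul_add] using ih k (by simp at hk; omega)

end IsPairedSorted

theorem exists_isPairedSorted_of_mem_closure {c : ℕ} {a : ℕ →₀ ℕ}
    (ha : a ∈ AddSubmonoid.closure (quadGens c)) :
    ∃ l, IsPairedSorted c l ∧ a = (l.map fun i => Finsupp.single i 1).sum := by
  induction ha using AddSubmonoid.closure_induction_left with
  | zero => exact ⟨[], .nil, by simp⟩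
  | add_left u hu b _ ih =>
    obtain ⟨i, j, hi, hij, hj, rfl⟩ := hu
    obtain ⟨l, hl, rfl⟩ := ih
    obtain ⟨l', hl', hperm⟩ := hl.exists_perm_cons_cons hi hij hj
    refine ⟨l', hl', ?_⟩
    rw [(hperm.map _).sum_eq]
    simp [add_assoc]

theorem Finset.sum_range_two_mul {M : Type*} [AddCommMonoid M] (g : ℕ → M) (d : ℕ) :
    ∑ k ∈ Finset.range (2 * d), g k = ∑ k ∈ Finset.range d, (g (2 * k) + g (2 * k + 1)) := by
  induction d with
  | zero => simp
  | succ d ih => rw [Finset.sum_range_succ, ← ih, Nat.mul_succ, Finset.sum_range_succ,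
      Finset.sum_range_succ, add_assoc]

/-- A monomial `x^a` lies in the multiplicative monoid generated by
`{x_i x_j : i ≥ 1, i ≤ j ≤ i + c}` iff there are `d ≥ 0` and a nondecreasing sequence of
positive integers `i_1 ≤ ⋯ ≤ i_{2d}` with `i_{2k} − i_{2k−1} ≤ c` for `1 ≤ k ≤ d`
such that `x^a = x_{i_1} x_{i_2} ⋯ x_{i_{2d}}`. -/
theorem stmt6 (c : ℕ) (a : ℕ →₀ ℕ) :
    a ∈ AddSubmonoid.closure (quadGens c) ↔
      ∃ (d : ℕ) (f : Fin (2 * d) → ℕ), Monotone f ∧ (∀ k, 1 ≤ f k) ∧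
        (∀ k : Fin d,
          f ⟨2 * (k : ℕ) + 1, by have := k.isLt; omega⟩ ≤
            f ⟨2 * (k : ℕ), by have := k.isLt; omega⟩ + c) ∧
        a = ∑ k : Fin (2 * d), Finsupp.single (f k) 1 := by
  constructor
  · intro ha
    obtain ⟨l, hl, rfl⟩ := exists_isPairedSorted_of_mem_closure ha
    obtain ⟨d, hd⟩ := hl.even_length.two_dvd
    refine ⟨d, fun k => l[(k : ℕ)], fun x y hxy => ?_, fun k => hl.one_le _ (l.getElem_mem _),
      fun k => hl.getElem_le k _, ?_⟩
    · exact hl.pairwise_le.rel_get_of_le (a := ⟨x, by omega⟩) (b := ⟨y, by omega⟩) hxy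
    · rw [← Fin.sum_univ_fun_getElem]
      exact Fintype.sum_equiv (finCongr hd) _ _ fun _ => rfl
  · rintro ⟨d, f, hf, hpos, hgap, rfl⟩
    rw [Finset.sum_fin_eq_sum_range, Finset.sum_range_two_mul]
    refine sum_mem fun k hk => AddSubmonoid.subset_closure ?_
    rw [Finset.mem_range] at hk
    rw [dif_pos (by omega), dif_pos (by omega)]
    exact ⟨_, _, hpos _, hf (Fin.mk_le_mk.2 (Nat.le_succ _)), hgap ⟨k, hk⟩, rfl⟩
end

section
/- Let K be a field, E = {(i, i+1) : i ≥ 1} ∪ {(i, i+2) : i ≥ 1}, and φ : K[x_e : e ∈ E] → K[x_i : i ≥ 1] the K-algebra homomorphism with φ(x_{(i,j)}) = x_i x_j. Let g = x^u − x^v ∈ ker φ be a nonzero binomial (u ≠ v, both finitely supported) such that the supports of u and v are disjoint, and let c be the smallest positive integer that is a component of some edge e ∈ E with u(e) ≠ 0 or v(e) ≠ 0. Then u((c, c+1)) − v((c, c+1)) = −(u((c, c+2)) − v((c, c+2))) and this common value is nonzero. -/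
/-- The index set `E = {(i, i+1) : i ≥ 1} ∪ {(i, i+2) : i ≥ 1}`. -/
def Edge : Type :=
  {e : ℕ × ℕ // 1 ≤ e.1 ∧ (e.2 = e.1 + 1 ∨ e.2 = e.1 + 2)}

/-- The toric map `φ : K[x_e : e ∈ E] → K[x_i : i ≥ 1]`, `x_{(i,j)} ↦ x_i x_j`. -/
noncomputable def phi (K : Type*) [Field K] :
    MvPolynomial Edge K →ₐ[K] MvPolynomial ℕ K :=
  MvPolynomial.aeval fun e : Edge => MvPolynomial.X e.val.1 * MvPolynomial.X e.val.2

open MvPolynomial in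
/-- If two monomials have the same image under `phi`, their degrees at every vertex agree. -/
theorem sum_incidence_eq_of_mem_ker (K : Type*) [Field K] (u v : Edge →₀ ℕ)
    (hker : (monomial u (1 : K) - monomial v 1) ∈ RingHom.ker (phi K)) (c : ℕ) :
    (u.sum fun e n => ((if e.val.1 = c then 1 else 0) + (if e.val.2 = c then 1 else 0)) * n) =
      v.sum fun e n => ((if e.val.1 = c then 1 else 0) + (if e.val.2 = c then 1 else 0)) * n := by
  let ψ : MvPolynomial ℕ K →ₐ[K] Polynomial K :=
    aeval fun n => (Polynomial.X : Polynomial K) ^ (if n = c then 1 else 0)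
  have key (w : Edge →₀ ℕ) : ψ (phi K (monomial w 1)) =
      (Polynomial.X : Polynomial K) ^ (w.sum fun e n =>
        ((if e.val.1 = c then 1 else 0) + (if e.val.2 = c then 1 else 0)) * n) := by
    simp only [ψ, phi, aeval_monomial, map_one, one_mul, Finsupp.prod, map_prod, map_pow,
      map_mul, aeval_X, ← pow_add, ← pow_mul, Finset.prod_pow_eq_pow_sum, Finsupp.sum]
  rw [RingHom.mem_ker, map_sub, sub_eq_zero] at hker
  have h := congrArg ψ hker
  rw [key, key] at h
  simpa using congrArg Polynomial.natDegree h

/-- At a vertex `c` below all components of the edges in the support, only the edges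
`(c, c + 1)` and `(c, c + 2)` contribute to the degree. -/
theorem sum_incidence_eq_add (w : Edge →₀ ℕ) (c : ℕ) (hc : 1 ≤ c)
    (hw : ∀ e : Edge, w e ≠ 0 → c ≤ e.val.1) :
    (w.sum fun e n => ((if e.val.1 = c then 1 else 0) + (if e.val.2 = c then 1 else 0)) * n) =
      w ⟨(c, c + 1), ⟨hc, Or.inl rfl⟩⟩ + w ⟨(c, c + 2), ⟨hc, Or.inr rfl⟩⟩ := by
  classical
  set e₁ : Edge := ⟨(c, c + 1), ⟨hc, Or.inl rfl⟩⟩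
  set e₂ : Edge := ⟨(c, c + 2), ⟨hc, Or.inr rfl⟩⟩
  have key : ∀ e ∈ w.support,
      ((if e.val.1 = c then 1 else 0) + (if e.val.2 = c then 1 else 0)) * w e =
        (if e₁ = e then w e else 0) + (if e₂ = e then w e else 0) := by
    intro e he
    have hle := hw e (Finsupp.mem_support_iff.mp he)
    have i₁ : e₁ = e ↔ c = e.val.1 ∧ c + 1 = e.val.2 := Subtype.ext_iff.trans Prod.ext_iff
    have i₂ : e₂ = e ↔ c = e.val.1 ∧ c + 2 = e.val.2 := Subtype.ext_iff.trans Prod.ext_iff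
    have hj := e.property.2
    simp only [i₁, i₂]
    split_ifs <;> omega
  rw [Finsupp.sum, Finset.sum_congr rfl key, Finset.sum_add_distrib, Finset.sum_ite_eq,
    Finset.sum_ite_eq]
  simp only [Finsupp.mem_support_iff, ne_eq, ite_not]
  split_ifs <;> simp_all

/-- If `g = x^u − x^v ∈ ker φ` is a nonzero binomial whose two monomials are coprime
(disjoint supports), and `c` is the smallest positive integer occurring as a component of
an edge in the support of `u` or `v`, then
`u(c, c+1) − v(c, c+1) = −(u(c, c+2) − v(c, c+2))` and this common value is nonzero. -/
theorem stmt11 (K : Type*) [Field K] (u v : Edge →₀ ℕ)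
    (hker : (MvPolynomial.monomial u (1 : K) - MvPolynomial.monomial v 1) ∈
      RingHom.ker (phi K))
    (hne : u ≠ v)
    (hdisj : Disjoint u.support v.support)
    (c : ℕ)
    (hc : IsLeast {n : ℕ | 1 ≤ n ∧
      ∃ e : Edge, (u e ≠ 0 ∨ v e ≠ 0) ∧ (n = e.val.1 ∨ n = e.val.2)} c) :
    ((u ⟨(c, c + 1), ⟨hc.1.1, Or.inl rfl⟩⟩ : ℤ) - v ⟨(c, c + 1), ⟨hc.1.1, Or.inl rfl⟩⟩ =
      -((u ⟨(c, c + 2), ⟨hc.1.1, Or.inr rfl⟩⟩ : ℤ) -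
          v ⟨(c, c + 2), ⟨hc.1.1, Or.inr rfl⟩⟩)) ∧
    (u ⟨(c, c + 1), ⟨hc.1.1, Or.inl rfl⟩⟩ : ℤ) - v ⟨(c, c + 1), ⟨hc.1.1, Or.inl rfl⟩⟩ ≠ 0 := by
  obtain ⟨⟨hc1, e, he, hce⟩, hmin⟩ := hc
  have hle : ∀ e : Edge, (u e ≠ 0 ∨ v e ≠ 0) → c ≤ e.val.1 := fun e he =>
    hmin ⟨e.property.1, e, he, Or.inl rfl⟩
  have hsum := sum_incidence_eq_of_mem_ker K u v hker c
  rw [sum_incidence_eq_add u c hc1 fun e he => hle e (Or.inl he),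
    sum_incidence_eq_add v c hc1 fun e he => hle e (Or.inr he)] at hsum
  have hcop : u e = 0 ∨ v e = 0 := by
    by_contra! h
    exact Finset.disjoint_left.mp hdisj (Finsupp.mem_support_iff.mpr h.1)
      (Finsupp.mem_support_iff.mpr h.2)
  have hlee := hle e he
  obtain ⟨⟨i, j⟩, hi, hj⟩ := e
  obtain rfl : c = i := by
    simp only at hce hlee hj
    omega
  refine ⟨by omega, ?_⟩
  rcases hj with hj | hj <;> simp only at hj <;> subst hj <;> omega
end

section
/- Let K be a field, σ a set, and I a prime ideal of the polynomial ring K[x_s : s ∈ σ] that contains no monomial. Suppose x^a − x^b ∈ I and g = x^u − x^v ∈ I are binomials (with a, b, u, v finitely supported functions σ → ℕ) such that a ≥ u componentwise and there exists v' with 0 ≤ v' ≤ v componentwise and b ≥ v − v' componentwise. Then the binomial x^{a − u + v'} − x^{b − (v − v')} belongs to I. -/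
open MvPolynomial

/-- Let `I` be a prime ideal of `K[x_s : s ∈ σ]` containing no monomial.  If
`x^a − x^b ∈ I` and `g = x^u − x^v ∈ I` with `a ≥ u` componentwise and
`b ≥ v − v' ≥ 0` componentwise for some `0 ≤ v' ≤ v`, then
`x^{a − u + v'} − x^{b − (v − v')} ∈ I`. -/
theorem stmt12 (K : Type*) [Field K] (σ : Type*)
    (I : Ideal (MvPolynomial σ K)) (hI : I.IsPrime)
    (hmono : ∀ e : σ →₀ ℕ, monomial e (1 : K) ∉ I)
    (a b u v v' : σ →₀ ℕ)
    (hab : monomial a (1 : K) - monomial b 1 ∈ I)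
    (huv : monomial u (1 : K) - monomial v 1 ∈ I)
    (hau : u ≤ a) (hv' : v' ≤ v) (hbv : v - v' ≤ b) :
    monomial (a - u + v') (1 : K) - monomial (b - (v - v')) 1 ∈ I := by
  obtain ⟨c, rfl⟩ := exists_add_of_le hau
  obtain ⟨w, rfl⟩ := exists_add_of_le hv'
  rw [add_tsub_cancel_left] at hbv ⊢
  obtain ⟨d, rfl⟩ := exists_add_of_le hbv
  rw [add_tsub_cancel_left, add_tsub_cancel_left]
  have h : monomial w (1 : K) * (monomial (c + v') 1 - monomial d 1) ∈ I := by
    convert I.sub_mem hab (I.mul_mem_left (monomial c (1 : K)) huv) using 1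
    simp only [mul_sub, monomial_mul, mul_one, add_comm u c, add_comm w (c + v'), add_assoc]
    ring
  exact (hI.mem_or_mem h).resolve_left (hmono w)
end

section
/- Let K be a field, σ a set, and I an ideal of the polynomial ring K[x_s : s ∈ σ] generated by a set B of binomials, where every element of B has the form x^u − x^v for finitely supported u, v : σ → ℕ. If x^a − x^b ∈ I with a ≠ b, then there exists a binomial x^u − x^v ∈ B such that a + u − v ≥ 0 componentwise or a − u + v ≥ 0 componentwise (as functions σ → ℤ). -/
open MvPolynomial

/-- Let `I` be an ideal of `K[x_s : s ∈ σ]` generated by a set `B` of binomials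
`x^u − x^v`.  If `x^a − x^b ∈ I` with `a ≠ b`, then there is a binomial
`x^u − x^v ∈ B` such that `a + u − v ≥ 0` componentwise or `a − u + v ≥ 0`
componentwise. -/
theorem stmt13 (K : Type*) [Field K] (σ : Type*)
    (B : Set (MvPolynomial σ K))
    (hB : ∀ f ∈ B, ∃ u v : σ →₀ ℕ, f = monomial u 1 - monomial v 1)
    (a b : σ →₀ ℕ) (hab : a ≠ b)
    (hmem : monomial a (1 : K) - monomial b 1 ∈ Ideal.span B) :
    ∃ u v : σ →₀ ℕ, (monomial u (1 : K) - monomial v 1) ∈ B ∧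
      ((∀ s : σ, v s ≤ a s + u s) ∨ (∀ s : σ, u s ≤ a s + v s)) := by
  classical
  by_contra! hcon
  have key : ∀ f ∈ Ideal.span B, ∀ g : MvPolynomial σ K, coeff a (g * f) = 0 := by
    intro f hf
    induction hf using Submodule.span_induction with
    | mem f hf =>
      intro g
      obtain ⟨u, v, rfl⟩ := hB f hf
      obtain ⟨⟨s, hs⟩, ⟨t, ht⟩⟩ := hcon u v hf
      have hu : ¬ u ≤ a := fun h => by have := h t; omega
      have hv : ¬ v ≤ a := fun h => by have := h s; omega
      rw [mul_sub, coeff_sub, coeff_mul_monomial', coeff_mul_monomial', if_neg hu, if_neg hv,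
        sub_zero]
    | zero => simp
    | add x y _ _ hx hy =>
      intro g
      rw [mul_add, coeff_add, hx, hy, add_zero]
    | smul r x _ hx =>
      intro g
      rw [smul_eq_mul, ← mul_assoc, hx]
  have h := key _ hmem 1
  simp [coeff_monomial, hab.symm] at h
end

section
/- Let K be a field and fix an integer c ≥ 1. Let ψ : K[x_{i,j} : 0 ≤ i ≤ c, j ≥ 1] → K[x_j : j ≥ 1] be the K-algebra homomorphism with ψ(x_{i,j}) = x_j x_{j+i}, and for k ≥ 0 let sh_k be the K-algebra endomorphism of the domain with sh_k(x_{i,j}) = x_{i,j+k}. Then ker ψ is finitely generated up to shift by quadrics: there exists a finite subset F ⊆ ker ψ consisting of homogeneous polynomials of degree 2 such that ker ψ equals the ideal generated by {sh_k(f) : f ∈ F, k ≥ 0}. -/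
open MvPolynomial

/-- The toric map `ψ : K[x_{i,j} : 0 ≤ i ≤ c, j ≥ 1] → K[x_j : j ≥ 1]` with
`ψ(x_{i,j}) = x_j x_{j+i}`.  The variable `x_{i,j}` is indexed by
`(i, j) : Fin (c+1) × ℕ+`. -/
noncomputable def psi (K : Type*) [Field K] (c : ℕ) :
    MvPolynomial (Fin (c + 1) × ℕ+) K →ₐ[K] MvPolynomial ℕ+ K :=
  aeval fun p : Fin (c + 1) × ℕ+ =>
    X p.2 * X (((p.2 : ℕ) + (p.1 : ℕ)).toPNat (Nat.add_pos_left p.2.pos _))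

/-- The shift endomorphism `sh_k` with `sh_k(x_{i,j}) = x_{i,j+k}`. -/
noncomputable def sh (K : Type*) [Field K] (c : ℕ) (k : ℕ) :
    MvPolynomial (Fin (c + 1) × ℕ+) K →ₐ[K] MvPolynomial (Fin (c + 1) × ℕ+) K :=
  aeval fun p : Fin (c + 1) × ℕ+ =>
    X (p.1, (⟨(p.2 : ℕ) + k, Nat.add_pos_left p.2.pos k⟩ : ℕ+))

/-- The shift `j ↦ j + k` on positive integers. -/
def shiftPNat (k : ℕ) (j : ℕ+) : ℕ+ := ⟨(j : ℕ) + k, Nat.add_pos_left j.pos k⟩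

theorem shiftPNat_injective (k : ℕ) : Function.Injective (shiftPNat k) := by
  intro a b h
  have h' := congrArg PNat.val h
  simp only [shiftPNat, PNat.mk_coe] at h'
  exact PNat.eq (by omega)

/-- The larger index `j + i` of the monomial `ψ(x_{i,j}) = x_j x_{j+i}`. -/
def rightEnd {c : ℕ} (p : Fin (c + 1) × ℕ+) : ℕ+ := shiftPNat p.1 p.2

theorem coe_rightEnd {c : ℕ} (p : Fin (c + 1) × ℕ+) :
    (rightEnd p : ℕ) = (p.2 : ℕ) + (p.1 : ℕ) := rfl

theorem ext_rightEnd {c : ℕ} {p q : Fin (c + 1) × ℕ+} (h : p.2 = q.2)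
    (h' : rightEnd p = rightEnd q) : p = q := by
  have h₁ := congrArg PNat.val h'
  have h₂ := congrArg PNat.val h
  simp only [coe_rightEnd] at h₁
  refine Prod.ext (Fin.ext ?_) h
  omega

/-- The multiset of indices occurring in `ψ` of the monomial with multiset of variables `s`. -/
def endpoints {c : ℕ} (s : Multiset (Fin (c + 1) × ℕ+)) : Multiset ℕ+ :=
  s.bind fun p => {p.2, rightEnd p}

theorem endpoints_cons {c : ℕ} (p : Fin (c + 1) × ℕ+) (s : Multiset (Fin (c + 1) × ℕ+)) :
    endpoints (p ::ₘ s) = p.2 ::ₘ rightEnd p ::ₘ endpoints s := by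
  simp [endpoints, Multiset.cons_swap]

theorem mem_endpoints {c : ℕ} {s : Multiset (Fin (c + 1) × ℕ+)} {a : ℕ+} :
    a ∈ endpoints s ↔ ∃ p ∈ s, a = p.2 ∨ a = rightEnd p := by
  simp only [endpoints, Multiset.mem_bind, Multiset.insert_eq_cons, Multiset.mem_cons,
    Multiset.mem_singleton]

/-- A minimal endpoint is the left end of some pair. -/
theorem exists_left_eq {c : ℕ} {s : Multiset (Fin (c + 1) × ℕ+)} {a : ℕ+}
    (ha : a ∈ endpoints s) (hmin : ∀ x ∈ endpoints s, a ≤ x) : ∃ p ∈ s, p.2 = a := by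
  obtain ⟨p, hp, h | h⟩ := mem_endpoints.1 ha
  · exact ⟨p, hp, h.symm⟩
  · refine ⟨p, hp, le_antisymm ?_ (hmin _ (mem_endpoints.2 ⟨p, hp, Or.inl rfl⟩))⟩
    rw [h, ← PNat.coe_le_coe, coe_rightEnd]
    omega

section

variable (K : Type*) [Field K] (c : ℕ)

theorem psi_X (p : Fin (c + 1) × ℕ+) : psi K c (X p) = X p.2 * X (rightEnd p) := by
  simp only [psi, aeval_X]
  rfl

theorem sh_X (k : ℕ) (p : Fin (c + 1) × ℕ+) :
    sh K c k (X p) = X (p.1, shiftPNat k p.2) := by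
  simp only [sh, aeval_X]
  rfl

theorem psi_sh (k : ℕ) (f : MvPolynomial (Fin (c + 1) × ℕ+) K) :
    psi K c (sh K c k f) = rename (shiftPNat k) (psi K c f) := by
  have : (psi K c).comp (sh K c k) = (rename (shiftPNat k)).comp (psi K c) := by
    refine algHom_ext fun p => ?_
    simp only [AlgHom.comp_apply, sh_X, psi_X, map_mul, rename_X]
    congr 2
    apply PNat.eq
    simp only [rightEnd, shiftPNat, PNat.mk_coe]
    omega
  exact DFunLike.congr_fun this f

theorem psi_sh_eq_zero_iff (k : ℕ) (f : MvPolynomial (Fin (c + 1) × ℕ+) K) :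
    psi K c (sh K c k f) = 0 ↔ psi K c f = 0 := by
  rw [psi_sh, map_eq_zero_iff _ (rename_injective _ (shiftPNat_injective k))]

/-- The binomial quadrics of `ker ψ` in the variables `x_{i,j}` with `j ≤ 2c + 1`. -/
def quadrics : Set (MvPolynomial (Fin (c + 1) × ℕ+) K) :=
  {g | psi K c g = 0 ∧ ∃ v : Fin 4 → Fin (c + 1) × ℕ+, (∀ i, ((v i).2 : ℕ) ≤ 2 * c + 1) ∧
    g = X (v 0) * X (v 1) - X (v 2) * X (v 3)}

theorem quadrics_finite : (quadrics K c).Finite := by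
  have hS : {p : Fin (c + 1) × ℕ+ | (p.2 : ℕ) ≤ 2 * c + 1}.Finite := by
    have : (Set.univ ×ˢ Set.Iic (⟨2 * c + 1, by omega⟩ : ℕ+) :
        Set (Fin (c + 1) × ℕ+)).Finite := Set.finite_univ.prod (Set.finite_Iic _)
    exact this.subset fun p hp => ⟨trivial, hp⟩
  have hV := Set.Finite.pi' (ι := Fin 4) fun _ => hS
  refine (hV.image fun v =>
    (X (v 0) * X (v 1) - X (v 2) * X (v 3) : MvPolynomial (Fin (c + 1) × ℕ+) K)).subset ?_
  rintro g ⟨-, v, hv, rfl⟩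
  exact ⟨v, hv, rfl⟩

theorem isHomogeneous_of_mem_quadrics {g : MvPolynomial (Fin (c + 1) × ℕ+) K}
    (hg : g ∈ quadrics K c) : g.IsHomogeneous 2 := by
  obtain ⟨-, v, -, rfl⟩ := hg
  exact ((isHomogeneous_X K _).mul (isHomogeneous_X K _)).sub
    ((isHomogeneous_X K _).mul (isHomogeneous_X K _))

/-- The ideal generated by all shifts of the quadrics. -/
noncomputable def quadricIdeal : Ideal (MvPolynomial (Fin (c + 1) × ℕ+) K) :=
  Ideal.span {g | ∃ f ∈ quadrics K c, ∃ k : ℕ, g = sh K c k f}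

theorem quadricIdeal_le_ker : quadricIdeal K c ≤ RingHom.ker (psi K c) := by
  refine Ideal.span_le.2 ?_
  rintro g ⟨f, hf, k, rfl⟩
  exact (psi_sh_eq_zero_iff K c k f).2 hf.1

theorem sub_mem_quadricIdeal {v : Fin 4 → Fin (c + 1) × ℕ+} {a : ℕ+}
    (hv : ∀ i, a ≤ (v i).2 ∧ ((v i).2 : ℕ) ≤ a + 2 * c)
    (h : psi K c (X (v 0) * X (v 1) - X (v 2) * X (v 3)) = 0) :
    (X (v 0) * X (v 1) - X (v 2) * X (v 3) : MvPolynomial (Fin (c + 1) × ℕ+) K)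
      ∈ quadricIdeal K c := by
  have ha := a.pos
  have hle : ∀ i, (a : ℕ) ≤ ((v i).2 : ℕ) := fun i => (hv i).1
  let w : Fin 4 → Fin (c + 1) × ℕ+ := fun i =>
    ((v i).1, ⟨((v i).2 : ℕ) - ((a : ℕ) - 1), by have := hle i; omega⟩)
  have hw : ∀ i, sh K c ((a : ℕ) - 1) (X (w i)) = X (v i) := by
    intro i
    rw [sh_X]
    congr 1
    refine Prod.ext rfl (PNat.eq ?_)
    have := hle i
    simp only [shiftPNat, w, PNat.mk_coe]
    omega
  have hs : sh K c ((a : ℕ) - 1) (X (w 0) * X (w 1) - X (w 2) * X (w 3)) =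
      X (v 0) * X (v 1) - X (v 2) * X (v 3) := by
    simp only [map_sub, map_mul, hw]
  refine Ideal.subset_span ⟨_, ⟨?_, w, ?_, rfl⟩, _, hs.symm⟩
  · rw [← psi_sh_eq_zero_iff K c ((a : ℕ) - 1), hs, h]
  · intro i
    have := (hv i).2
    simp only [w, PNat.mk_coe]
    omega

/-- Modulo the quadrics, the pair of the two smallest endpoints can be split off. -/
theorem exists_split {s : Multiset (Fin (c + 1) × ℕ+)} {a b : ℕ+} {M : Multiset ℕ+}
    (hs : endpoints s = a ::ₘ b ::ₘ M) (hab : a ≤ b) (hM : ∀ x ∈ M, b ≤ x) :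
    ∃ (e : Fin (c + 1) × ℕ+) (t : Multiset (Fin (c + 1) × ℕ+)), e.2 = a ∧ rightEnd e = b ∧
      endpoints t = M ∧
      ((s.map X).prod - X e * (t.map X).prod : MvPolynomial (Fin (c + 1) × ℕ+) K)
        ∈ quadricIdeal K c := by
  obtain ⟨p, hp, rfl⟩ : ∃ p ∈ s, p.2 = a := by
    refine exists_left_eq (by simp [hs]) fun x hx => ?_
    rw [hs] at hx
    rcases Multiset.mem_cons.1 hx with rfl | hx
    · exact le_rfl
    rcases Multiset.mem_cons.1 hx with rfl | hx
    · exact hab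
    · exact hab.trans (hM x hx)
  obtain ⟨s, rfl⟩ := Multiset.exists_cons_of_mem hp
  rw [endpoints_cons, Multiset.cons_inj_right] at hs
  by_cases hb : rightEnd p = b
  · rw [hb, Multiset.cons_inj_right] at hs
    exact ⟨p, s, rfl, hb, hs, by simp⟩
  have hmin : ∀ x ∈ rightEnd p ::ₘ endpoints s, b ≤ x := by
    rw [hs]
    intro x hx
    rcases Multiset.mem_cons.1 hx with rfl | hx
    exacts [le_rfl, hM x hx]
  have hbs : b ∈ endpoints s := by
    have : b ∈ rightEnd p ::ₘ endpoints s := by simp [hs]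
    exact (Multiset.mem_cons.1 this).resolve_left (Ne.symm hb)
  obtain ⟨q, hq, rfl⟩ := exists_left_eq hbs fun x hx => hmin x (Multiset.mem_cons_of_mem hx)
  obtain ⟨s, rfl⟩ := Multiset.exists_cons_of_mem hq
  rw [endpoints_cons, Multiset.cons_swap, Multiset.cons_inj_right] at hs
  have hqp : (q.2 : ℕ) ≤ rightEnd p := hmin _ (by simp)
  have hpq : (p.2 : ℕ) ≤ q.2 := hab
  have hp₁ := p.1.isLt
  have hq₁ := q.1.isLt
  have hpr := coe_rightEnd p
  have hqr := coe_rightEnd q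
  let e : Fin (c + 1) × ℕ+ := (⟨(q.2 : ℕ) - p.2, by omega⟩, p.2)
  have he : rightEnd e = q.2 := by
    apply PNat.eq
    simp only [coe_rightEnd, e]
    omega
  obtain ⟨f, hf⟩ : ∃ f : Fin (c + 1) × ℕ+,
      (f.2 = rightEnd p ∧ rightEnd f = rightEnd q) ∨
        (f.2 = rightEnd q ∧ rightEnd f = rightEnd p) := by
    rcases le_total (rightEnd p : ℕ) (rightEnd q) with h | h
    · refine ⟨(⟨(rightEnd q : ℕ) - rightEnd p, by omega⟩, rightEnd p), Or.inl ⟨rfl, ?_⟩⟩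
      apply PNat.eq
      rw [coe_rightEnd]
      simp only
      omega
    · refine ⟨(⟨(rightEnd p : ℕ) - rightEnd q, by omega⟩, rightEnd q), Or.inr ⟨rfl, ?_⟩⟩
      apply PNat.eq
      rw [coe_rightEnd]
      simp only
      omega
  have hquad : (X p * X q - X e * X f : MvPolynomial (Fin (c + 1) × ℕ+) K)
      ∈ quadricIdeal K c := by
    refine sub_mem_quadricIdeal K c (v := ![p, q, e, f]) (a := p.2) ?_ ?_
    · have hf₂ : (f.2 : ℕ) = rightEnd p ∨ (f.2 : ℕ) = rightEnd q :=
        hf.imp (fun h => congrArg PNat.val h.1) fun h => congrArg PNat.val h.1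
      have key : ∀ r : Fin (c + 1) × ℕ+, (p.2 : ℕ) ≤ r.2 → (r.2 : ℕ) ≤ p.2 + 2 * c →
          p.2 ≤ r.2 ∧ (r.2 : ℕ) ≤ p.2 + 2 * c := fun r h h' => ⟨h, h'⟩
      intro i
      fin_cases i
      · exact key p le_rfl (by omega)
      · exact key q hab (by omega)
      · exact key e le_rfl (by simp only [e]; omega)
      · exact key f (by omega) (by omega)
    · change psi K c (X p * X q - X e * X f) = 0
      simp only [map_sub, map_mul, psi_X, he]
      rcases hf with ⟨h, h'⟩ | ⟨h, h'⟩ <;> rw [h, h'] <;> simp only [e] <;> ring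
  refine ⟨e, f ::ₘ s, rfl, he, ?_, ?_⟩
  · rw [endpoints_cons, ← hs]
    rcases hf with ⟨h, h'⟩ | ⟨h, h'⟩
    · rw [h, h']
    · rw [h, h', Multiset.cons_swap]
  · convert Ideal.mul_mem_right (s.map X).prod _ hquad using 1
    simp only [Multiset.map_cons, Multiset.prod_cons]
    ring

theorem exists_min_cons {M : Multiset ℕ+} (hM : M ≠ 0) :
    ∃ a N, M = a ::ₘ N ∧ ∀ x ∈ N, a ≤ x := by
  obtain ⟨a, ha, hmin⟩ := M.toFinset.exists_min_image id (by simpa using hM)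
  obtain ⟨N, rfl⟩ := Multiset.exists_cons_of_mem (Multiset.mem_toFinset.1 ha)
  exact ⟨a, N, rfl, fun x hx => hmin x (by simp [hx])⟩

theorem prod_sub_prod_mem (s t : Multiset (Fin (c + 1) × ℕ+)) (h : endpoints s = endpoints t) :
    ((s.map X).prod - (t.map X).prod : MvPolynomial (Fin (c + 1) × ℕ+) K)
      ∈ quadricIdeal K c := by
  induction hn : Multiset.card (endpoints s) using Nat.strong_induction_on generalizing s t with
  | _ n ih =>
  rcases s.empty_or_exists_mem with rfl | ⟨p, hp⟩
  · rcases t.empty_or_exists_mem with rfl | ⟨q, hq⟩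
    · simp
    · obtain ⟨t, rfl⟩ := Multiset.exists_cons_of_mem hq
      rw [endpoints_cons] at h
      simp [endpoints] at h
  obtain ⟨a, N, hN, ha⟩ := exists_min_cons (M := endpoints s) fun h0 => by
    have := mem_endpoints.2 ⟨p, hp, Or.inl rfl⟩
    simp [h0] at this
  obtain ⟨b, M, rfl, hb⟩ := exists_min_cons (M := N) fun h0 => by
    obtain ⟨s, rfl⟩ := Multiset.exists_cons_of_mem hp
    have := congrArg Multiset.card hN
    simp [endpoints_cons, h0] at this
  have hab := ha b (by simp)
  obtain ⟨e, s', he, he', hs', hse⟩ := exists_split K c hN hab hb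
  obtain ⟨f, t', hf, hf', ht', htf⟩ := exists_split K c (h.symm.trans hN) hab hb
  obtain rfl : e = f := ext_rightEnd (he.trans hf.symm) (he'.trans hf'.symm)
  have hst := ih _ (by rw [← hn, hN, hs']; simp) s' t' (hs'.trans ht'.symm) rfl
  convert Ideal.add_mem _ (Ideal.sub_mem _ hse htf) (Ideal.mul_mem_left _ (X e) hst) using 1
  ring

theorem monomial_toFinsupp {σ : Type*} [DecidableEq σ] (s : Multiset σ) :
    (monomial (Multiset.toFinsupp s) 1 : MvPolynomial σ K) = (s.map X).prod := by
  induction s using Multiset.induction_on with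
  | empty => simp
  | cons a s ih =>
    rw [Multiset.map_cons, Multiset.prod_cons, ← ih, ← Multiset.singleton_add, map_add,
      Multiset.toFinsupp_singleton, X, monomial_mul, one_mul]

theorem psi_prod (s : Multiset (Fin (c + 1) × ℕ+)) :
    psi K c (s.map X).prod = monomial (Multiset.toFinsupp (endpoints s)) 1 := by
  rw [monomial_toFinsupp]
  induction s using Multiset.induction_on with
  | empty => simp [endpoints]
  | cons p s ih =>
    simp only [Multiset.map_cons, Multiset.prod_cons, endpoints_cons, map_mul, ih, psi_X]
    ring

theorem ker_le_quadricIdeal : RingHom.ker (psi K c) ≤ quadricIdeal K c := by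
  classical
  let σ : MvPolynomial ℕ+ K →ₗ[K] MvPolynomial (Fin (c + 1) × ℕ+) K ⧸ quadricIdeal K c :=
    (basisMonomials ℕ+ K).constr K fun m =>
      if h : ∃ s, Multiset.toFinsupp (endpoints (c := c) s) = m then
        Ideal.Quotient.mk _ (h.choose.map X).prod
      else 0
  have hσ : σ ∘ₗ (psi K c).toLinearMap = (Ideal.Quotient.mkₐ K (quadricIdeal K c)).toLinearMap := by
    refine (basisMonomials _ K).ext fun u => ?_
    obtain ⟨s, rfl⟩ := Multiset.toFinsupp.surjective u
    have h : ∃ t, Multiset.toFinsupp (endpoints (c := c) t) =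
      Multiset.toFinsupp (endpoints s) := ⟨s, rfl⟩
    have hm : σ (monomial (Multiset.toFinsupp (endpoints s)) 1) =
        Ideal.Quotient.mk _ (h.choose.map X).prod := by
      have hb := (basisMonomials ℕ+ K).constr_basis K (fun m =>
        if h : ∃ s, Multiset.toFinsupp (endpoints (c := c) s) = m then
          Ideal.Quotient.mk (quadricIdeal K c) (h.choose.map X).prod
        else 0) (Multiset.toFinsupp (endpoints s))
      rw [dif_pos h, coe_basisMonomials] at hb
      exact hb
    simp only [coe_basisMonomials, LinearMap.comp_apply, AlgHom.toLinearMap_apply,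
      monomial_toFinsupp, psi_prod]
    rw [← monomial_toFinsupp, hm]
    exact Ideal.Quotient.eq.2
      (prod_sub_prod_mem K c _ _ (Multiset.toFinsupp.injective h.choose_spec))
  intro f hf
  have hf' := LinearMap.congr_fun hσ f
  rw [LinearMap.comp_apply, AlgHom.toLinearMap_apply, (RingHom.mem_ker).1 hf, map_zero] at hf'
  exact Ideal.Quotient.eq_zero_iff_mem.1 hf'.symm

end

/-- `ker ψ` is finitely generated up to shift by quadrics: there is a finite set `F` of
homogeneous polynomials of degree `2` in `ker ψ` such that `ker ψ` is generated by the
shifts `sh_k(f)`, `f ∈ F`, `k ≥ 0`. -/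
theorem stmt15 (K : Type*) [Field K] (c : ℕ) (hc : 1 ≤ c) :
    ∃ F : Finset (MvPolynomial (Fin (c + 1) × ℕ+) K),
      (∀ f ∈ F, f ∈ RingHom.ker (psi K c) ∧ f.IsHomogeneous 2) ∧
      Ideal.span {g | ∃ f ∈ F, ∃ k : ℕ, g = sh K c k f} = RingHom.ker (psi K c) := by
  refine ⟨(quadrics_finite K c).toFinset, fun f hf => ?_, ?_⟩
  · rw [Set.Finite.mem_toFinset] at hf
    exact ⟨hf.1, isHomogeneous_of_mem_quadrics K c hf⟩
  · simp only [Set.Finite.mem_toFinset]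
    exact le_antisymm (quadricIdeal_le_ker K c) (ker_le_quadricIdeal K c)
end
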